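/- Suppose the combiner H : α → α → α is pairwise injective, i.e., H a b = H c d implies a = c and b = d. Then the Merkle root function is injective on lists of any fixed length: for all nonempty lists hs and hs' of leaf hashes with hs.length = hs'.length, if root(hs) = root(hs') then hs = hs'. -/

import Mathlib

/-- Side of a sibling hash in an inclusion proof. -/
inductive Side
  | left
  | right
deriving DecidableEq, Repr

/-- One Merkle level step: combine consecutive pairs with `H`,
promoting an unpaired final element unchanged. -/
def levelStep {α : Type*} (H : α → α → α) : List α → List α
  | a :: b :: rest => H a b :: levelStep H rest
  | l => l

theorem levelStep_length {α : Type*} (H : α → α → α) :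
    (l : List α) → (levelStep H l).length = (l.length + 1) / 2
  | [] => by simp [levelStep]
  | [_] => by simp [levelStep]
  | a :: b :: rest => by
      simp only [levelStep, List.length_cons, levelStep_length H rest]
      omega

/-- The Merkle root of a list of leaf hashes (`none` on the empty list),
obtained by iterating the level step until a single hash remains. -/
def merkleRoot? {α : Type*} (H : α → α → α) : List α → Option α
  | [] => none
  | [a] => some a
  | a :: b :: rest => merkleRoot? H (levelStep H (a :: b :: rest))
termination_by l => l.length
decreasing_by
  simp only [levelStep_length, List.length_cons]
  omega

theorem levelStep_inj_aux {α : Type*} (H : α → α → α)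
    (hH : ∀ a b c d : α, H a b = H c d → a = c ∧ b = d) :
    (l l' : List α) → l.length = l'.length → levelStep H l = levelStep H l' → l = l'
  | [], [], _, _ => rfl
  | [_], [_], _, h => by simpa [levelStep] using h
  | a :: b :: r, c :: d :: r', hl, h => by
      simp only [levelStep, List.cons.injEq] at h
      obtain ⟨h1, h2⟩ := h
      obtain ⟨rfl, rfl⟩ := hH _ _ _ _ h1
      rw [levelStep_inj_aux H hH r r' (by simpa using hl) h2]
  | [], _ :: _, hl, _ => by simp at hl
  | _ :: _, [], hl, _ => by simp at hl
  | [_], _ :: _ :: _, hl, _ => by simp at hl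
  | _ :: _ :: _, [_], hl, _ => by simp at hl

theorem merkleRoot_inj_aux {α : Type*} (H : α → α → α)
    (hH : ∀ a b c d : α, H a b = H c d → a = c ∧ b = d) (n : ℕ) :
    ∀ l l' : List α, l.length = n → l'.length = n →
      merkleRoot? H l = merkleRoot? H l' → l = l' := by
  induction n using Nat.strong_induction_on with
  | _ n ih =>
    intro l l' hl hl' h
    match l, l', hl, hl', h with
    | [], l', hl, hl', _ =>
      have : l'.length = 0 := by rw [hl', ← hl]; rfl
      exact (List.length_eq_zero_iff.mp this).symm
    | [a], l', hl, hl', h =>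
      have : l'.length = 1 := by rw [hl', ← hl]; rfl
      obtain ⟨b, rfl⟩ := List.length_eq_one_iff.mp this
      simpa [merkleRoot?] using h
    | a :: b :: r, [], hl, hl', _ => simp at hl hl'; omega
    | a :: b :: r, [_], hl, hl', _ => simp at hl hl'; omega
    | a :: b :: r, c :: d :: r', hl, hl', h =>
      rw [merkleRoot?, merkleRoot?] at h
      refine levelStep_inj_aux H hH _ _ (hl.trans hl'.symm) ?_
      refine ih ((n + 1) / 2) ?_ _ _ ?_ ?_ h
      · simp at hl; omega
      · rw [levelStep_length, hl]
      · rw [levelStep_length, hl']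

/-- If the combiner `H` is pairwise injective, then the Merkle root function is
injective on lists of any fixed length: for all nonempty lists `hs` and `hs'`
of leaf hashes with `hs.length = hs'.length`, if the roots agree then the lists
agree. -/
theorem merkleRoot_injective_of_length_eq {α : Type*} (H : α → α → α)
    (hH : ∀ a b c d : α, H a b = H c d → a = c ∧ b = d)
    (hs hs' : List α) (hne : hs ≠ []) (hne' : hs' ≠ [])
    (hlen : hs.length = hs'.length)
    (hroot : merkleRoot? H hs = merkleRoot? H hs') :
    hs = hs' := by
  exact merkleRoot_inj_aux H hH hs.length hs hs' rfl hlen.symm hroot
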